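/- arXiv:2411.16315 — 2 statements merged into one kernel-verified Lean document; each statement's English description precedes it below -/
import Mathlib

section
/- Let M be a MAG over V = {X, Y} ∪ O satisfying the pretreatment setup. Then some subset of O satisfies the generalized adjustment criterion relative to (X, Y) in M if and only if some subset of MB(Y) \ {X} satisfies the generalized adjustment criterion relative to (X, Y) in M. (Theorem 1: Existence of an adjustment set within the Markov blanket.) -/
namespace CausalGraph

/-- A directed mixed graph: directed edges `dir a b` (a → b) and bidirected
edges `bidir a b` (a ↔ b), with at most one edge between any two vertices
and no self-loops. -/
structure MixedGraph (V : Type*) where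
  dir : V → V → Prop
  bidir : V → V → Prop
  bidir_symm : ∀ a b, bidir a b → bidir b a
  dir_irrefl : ∀ a, ¬ dir a a
  bidir_irrefl : ∀ a, ¬ bidir a a
  dir_not_dir : ∀ a b, dir a b → ¬ dir b a
  dir_not_bidir : ∀ a b, dir a b → ¬ bidir a b

variable {V : Type*}

/-- Two vertices are adjacent if there is an edge (of any kind) between them. -/
def MixedGraph.adj (G : MixedGraph V) (a b : V) : Prop :=
  G.dir a b ∨ G.dir b a ∨ G.bidir a b

/-- There is an edge between `a` and `b` with an arrowhead at `b`. -/
def ArrowInto (G : MixedGraph V) (a b : V) : Prop :=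
  G.dir a b ∨ G.bidir a b

/-- `p` is a path between `a` and `b`: a list of distinct vertices, each
consecutive pair adjacent, starting at `a` and ending at `b`. -/
def IsPathBetween (G : MixedGraph V) (p : List V) (a b : V) : Prop :=
  List.Chain' G.adj p ∧ p.Nodup ∧ p.head? = some a ∧ p.getLast? = some b ∧ 2 ≤ p.length

/-- `p` is a directed path from `a` to `b`: all edges are directed edges
pointing toward `b`. -/
def IsDirectedPath (G : MixedGraph V) (p : List V) (a b : V) : Prop :=
  List.Chain' G.dir p ∧ p.Nodup ∧ p.head? = some a ∧ p.getLast? = some b ∧ 2 ≤ p.length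

/-- `a` is an ancestor of `b` (and `b` a descendant of `a`): `a = b` or there
is a directed path from `a` to `b`. -/
def Ancestor (G : MixedGraph V) (a b : V) : Prop :=
  a = b ∨ ∃ p, IsDirectedPath G p a b

/-- `w` is an intermediate (non-endpoint) vertex of the path `p`. -/
def IsIntermediateOn (p : List V) (w : V) : Prop :=
  ∃ (u v : V) (l₁ l₂ : List V), p = l₁ ++ u :: w :: v :: l₂

/-- `w` is a collider on the path `p`: both edges of the path at `w` have an
arrowhead at `w`. -/
def IsColliderOn (G : MixedGraph V) (p : List V) (w : V) : Prop :=
  ∃ (u v : V) (l₁ l₂ : List V), p = l₁ ++ u :: w :: v :: l₂ ∧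
    ArrowInto G u w ∧ ArrowInto G v w

/-- `w` is a non-collider intermediate vertex on the path `p`. -/
def IsNonColliderOn (G : MixedGraph V) (p : List V) (w : V) : Prop :=
  IsIntermediateOn p w ∧ ¬ IsColliderOn G p w

/-- The path `p` between `a` and `b` (with `a, b ∉ Z`) is m-connecting given
`Z`: every non-collider on it is not in `Z`, and every collider on it has a
descendant in `Z`. -/
def MConnPath (G : MixedGraph V) (Z : Set V) (p : List V) (a b : V) : Prop :=
  IsPathBetween G p a b ∧ a ∉ Z ∧ b ∉ Z ∧
    (∀ w, IsNonColliderOn G p w → w ∉ Z) ∧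
    (∀ w, IsColliderOn G p w → ∃ d ∈ Z, Ancestor G w d)

/-- `a` and `b` are m-separated by `Z`: no path between them is m-connecting
given `Z`. -/
def MSep (G : MixedGraph V) (Z : Set V) (a b : V) : Prop :=
  ∀ p, ¬ MConnPath G Z p a b

/-- `a` and `b` are m-connected given `Z`. -/
def MConn (G : MixedGraph V) (Z : Set V) (a b : V) : Prop :=
  ∃ p, MConnPath G Z p a b

/-- Set version of m-separation: every vertex of `A` is m-separated from every
vertex of `B` by `Z`. -/
def MSepSets (G : MixedGraph V) (Z A B : Set V) : Prop :=
  ∀ a ∈ A, ∀ b ∈ B, MSep G Z a b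

/-- `G` is a maximal ancestral graph (MAG): it is ancestral (no directed or
almost directed cycles), and every pair of distinct non-adjacent vertices is
m-separated by some set of vertices. -/
def IsMAG (G : MixedGraph V) : Prop :=
  (∀ a b, G.dir a b → ¬ Ancestor G b a) ∧
  (∀ a b, G.bidir a b → ¬ Ancestor G a b) ∧
  (∀ a b, a ≠ b → ¬ G.adj a b → ∃ Z : Set V, a ∉ Z ∧ b ∉ Z ∧ MSep G Z a b)

/-- `p` is a collider path between `a` and `b`: every intermediate vertex is a
collider on it. -/
def IsColliderPathBetween (G : MixedGraph V) (p : List V) (a b : V) : Prop :=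
  IsPathBetween G p a b ∧ ∀ w, IsIntermediateOn p w → IsColliderOn G p w

/-- The Markov blanket of `y`: all vertices adjacent to `y`, together with all
vertices non-adjacent to `y` joined to `y` by a collider path. -/
def MarkovBlanket (G : MixedGraph V) (y : V) : Set V :=
  {v | v ≠ y ∧ (G.adj v y ∨ (¬ G.adj v y ∧ ∃ p, IsColliderPathBetween G p v y))}

/-- The directed edge `x → y` is visible: there is a vertex `s` not adjacent
to `y` such that either there is an edge between `s` and `x` with an arrowhead
at `x`, or there is a collider path from `s` to `x` with an arrowhead at `x`
all of whose intermediate vertices are parents of `y`. -/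
def VisibleEdge (G : MixedGraph V) (x y : V) : Prop :=
  G.dir x y ∧ ∃ s, s ≠ y ∧ ¬ G.adj s y ∧
    (ArrowInto G s x ∨
      ∃ p, IsColliderPathBetween G p s x ∧
        (∃ (l : List V) (u : V), p = l ++ [u, x] ∧ ArrowInto G u x) ∧
        (∀ w, IsIntermediateOn p w → G.dir w y))

/-- A non-causal path from `x` to `y`: a path between `x` and `y` that is not
a directed path from `x` to `y`. -/
def NonCausalPath (G : MixedGraph V) (p : List V) (a b : V) : Prop :=
  IsPathBetween G p a b ∧ ¬ IsDirectedPath G p a b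

/-- `Z` blocks every non-causal path from `x` to `y`. -/
def BlocksAllNonCausal (G : MixedGraph V) (x y : V) (Z : Set V) : Prop :=
  ∀ p, NonCausalPath G p x y → ¬ MConnPath G Z p x y

/-- `Z` satisfies the generalized adjustment criterion relative to `(x, y)`:
every directed path from `x` to `y` starts with a visible directed edge out of
`x`, `Z` contains no descendant of any vertex lying on a directed path from
`x` to `y`, and `Z` blocks every non-causal path from `x` to `y`. -/
def ValidAdjustment (G : MixedGraph V) (x y : V) (Z : Set V) : Prop :=
  (∀ (p : List V) (w : V) (l : List V),
      IsDirectedPath G p x y → p = x :: w :: l → VisibleEdge G x w) ∧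
  (∀ v ∈ Z, ¬ ∃ (w : V) (p : List V), IsDirectedPath G p x y ∧ w ∈ p ∧ Ancestor G w v) ∧
  BlocksAllNonCausal G x y Z

/-- Pretreatment setup: `G` is a MAG over `V = {x, y} ∪ O`, `x ≠ y`, `y` is
not an ancestor of `x`, and neither `x` nor `y` is an ancestor of any vertex
of `O`. -/
structure Pretreatment (G : MixedGraph V) (x y : V) (O : Set V) : Prop where
  mag : IsMAG G
  ne : x ≠ y
  x_not_mem : x ∉ O
  y_not_mem : y ∉ O
  cover : (Set.univ : Set V) = {x, y} ∪ O
  y_not_anc_x : ¬ Ancestor G y x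
  x_not_anc_O : ∀ v ∈ O, ¬ Ancestor G x v
  y_not_anc_O : ∀ v ∈ O, ¬ Ancestor G y v

open Relation

/-- Every consecutive triple of the list satisfies `R`. -/
def Trip (R : V → V → V → Prop) (p : List V) : Prop :=
  ∀ l₁ u w v l₂, p = l₁ ++ u :: w :: v :: l₂ → R u w v

theorem Trip.suffix {R : V → V → V → Prop} {l m : List V} (h : Trip R (l ++ m)) : Trip R m := by
  intro l₁ u w v l₂ e
  exact h (l ++ l₁) u w v l₂ (by simp [e])

theorem Trip.pref {R : V → V → V → Prop} {l m : List V} (h : Trip R (l ++ m)) : Trip R l := by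
  intro l₁ u w v l₂ e
  exact h l₁ u w v (l₂ ++ m) (by simp [e])

theorem Trip.nil {R : V → V → V → Prop} : Trip R [] := by
  intro l₁ u w v l₂ e
  have := congrArg List.length e
  simp at this

theorem Trip.one {R : V → V → V → Prop} {a : V} : Trip R [a] := by
  intro l₁ u w v l₂ e
  have := congrArg List.length e
  simp at this
  omega

theorem Trip.two {R : V → V → V → Prop} {a b : V} : Trip R [a, b] := by
  intro l₁ u w v l₂ e
  have := congrArg List.length e
  simp at this
  omega

theorem Trip.cons {R : V → V → V → Prop} {a b c : V} {l : List V} (h : R a b c)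
    (h' : Trip R (b :: c :: l)) : Trip R (a :: b :: c :: l) := by
  intro l₁ u w v l₂ e
  cases l₁ with
  | nil => simp at e; obtain ⟨rfl, rfl, rfl, rfl⟩ := e; exact h
  | cons z l₁ => simp at e; exact h' l₁ u w v l₂ e.2

theorem Trip.head {R : V → V → V → Prop} {a b c : V} {l : List V}
    (h : Trip R (a :: b :: c :: l)) : R a b c := h [] a b c l rfl

theorem Trip.tail {R : V → V → V → Prop} {a : V} {l : List V}
    (h : Trip R (a :: l)) : Trip R l := Trip.suffix (l := [a]) h

/-- collider triple -/
def Coll (H : MixedGraph V) (u w v : V) : Prop := ArrowInto H u w ∧ ArrowInto H v w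

/-- ancestor of the set -/
def AncSet (H : MixedGraph V) (Z : Set V) (w : V) : Prop := ∃ d ∈ Z, ReflTransGen H.dir w d

/-- open triple -/
def OKT (H : MixedGraph V) (Z : Set V) (u w v : V) : Prop :=
  (Coll H u w v ∧ AncSet H Z w) ∨ (¬ Coll H u w v ∧ w ∉ Z)

theorem MixedGraph.adj_symm {H : MixedGraph V} {a b : V} (h : H.adj a b) : H.adj b a := by
  rcases h with h | h | h
  · exact Or.inr (Or.inl h)
  · exact Or.inl h
  · exact Or.inr (Or.inr (H.bidir_symm _ _ h))

theorem not_arrow {H : MixedGraph V} {w v : V} (h : H.dir w v) : ¬ ArrowInto H v w := by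
  rintro (h' | h')
  · exact H.dir_not_dir _ _ h h'
  · exact H.dir_not_bidir _ _ h (H.bidir_symm _ _ h')

theorem dir_of_not_arrow {H : MixedGraph V} {w v : V} (h : H.adj w v) (h' : ¬ ArrowInto H v w) :
    H.dir w v := by
  rcases h with h | h | h
  · exact h
  · exact absurd (Or.inl h) h'
  · exact absurd (Or.inr (H.bidir_symm _ _ h)) h'

theorem rtg_of_chain {H : MixedGraph V} : ∀ {l : List V} {a : V}, (a :: l).IsChain H.dir →
    ∀ w ∈ a :: l, ReflTransGen H.dir a w := by
  intro l
  induction l with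
  | nil => intro a _ w hw; simp at hw; subst hw; exact .refl
  | cons b l ih =>
    intro a h w hw
    rw [List.isChain_cons_cons] at h
    rcases List.mem_cons.1 hw with rfl | hw
    · exact .refl
    · exact .head h.1 (ih h.2 w hw)

theorem path_of_rtg {H : MixedGraph V} {a b : V} (h : ReflTransGen H.dir a b) :
    ∃ l, (a :: l).IsChain H.dir ∧ (a :: l).Nodup ∧ (a :: l).getLast? = some b := by
  induction h using ReflTransGen.head_induction_on with
  | refl => exact ⟨[], by simp⟩
  | head hac hcb ih =>
    rename_i a c
    obtain ⟨l, h1, h2, h3⟩ := ih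
    by_cases ha : a ∈ c :: l
    · obtain ⟨s, t, e⟩ := List.append_of_mem ha
      rw [e] at h1 h2 h3
      refine ⟨t, h1.right_of_append, (List.nodup_append.1 h2).2.1, ?_⟩
      simpa [List.getLast?_append] using h3
    · refine ⟨c :: l, List.isChain_cons_cons.2 ⟨hac, h1⟩, List.nodup_cons.2 ⟨ha, h2⟩, ?_⟩
      simpa using h3

theorem anc_iff {H : MixedGraph V} {a b : V} : Ancestor H a b ↔ ReflTransGen H.dir a b := by
  constructor
  · rintro (rfl | ⟨p, h1, h2, h3, h4, h5⟩)
    · exact .refl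
    · cases p with
      | nil => simp at h3
      | cons c l =>
        simp at h3; subst h3
        exact rtg_of_chain h1 b (List.mem_of_getLast? h4)
  · intro h
    obtain ⟨l, h1, h2, h3⟩ := path_of_rtg h
    cases l with
    | nil => simp at h3; exact Or.inl h3
    | cons c l => exact Or.inr ⟨_, h1, h2, rfl, h3, by simp⟩

theorem split_list (S P Q : V → Prop) : ∀ (l : List V) (a : V) (m : List V), P a →
    (∀ w ∈ m, S w) → (∀ w ∈ l, S w ∨ P w ∨ Q w) → (∃ w ∈ l, Q w) →
    ∃ l₁ a' mid b l₂, a :: (m ++ l) = l₁ ++ a' :: (mid ++ b :: l₂) ∧ P a' ∧ Q b ∧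
      ∀ w ∈ mid, S w := by
  intro l
  induction l with
  | nil => intro a m _ _ _ h; simp at h
  | cons c l ih =>
    intro a m ha hm hl hq
    by_cases hc : Q c
    · exact ⟨[], a, m, c, l, rfl, ha, hc, hm⟩
    have hq' : ∃ w ∈ l, Q w := by
      obtain ⟨w, hw, hw'⟩ := hq
      rcases List.mem_cons.1 hw with rfl | hw
      · exact absurd hw' hc
      · exact ⟨w, hw, hw'⟩
    have hl' : ∀ w ∈ l, S w ∨ P w ∨ Q w := fun w hw => hl w (List.mem_cons_of_mem _ hw)
    rcases hl c (by simp) with h | h | h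
    · obtain ⟨l₁, a', mid, b, l₂, e, h'⟩ := ih a (m ++ [c]) ha
        (by intro w hw; rcases List.mem_append.1 hw with hw | hw
            · exact hm w hw
            · simp at hw; subst hw; exact h) hl' hq'
      exact ⟨l₁, a', mid, b, l₂, by simpa using e, h'⟩
    · obtain ⟨l₁, a', mid, b, l₂, e, h'⟩ := ih c [] h (by simp) hl' hq'
      refine ⟨a :: (m ++ l₁), a', mid, b, l₂, ?_, h'⟩
      simp at e
      simp [e]
    · exact absurd h hc

theorem last_common (B : List V) : ∀ A : List V, (∃ w ∈ A, w ∈ B) →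
    ∃ A₁ w A₂, A = A₁ ++ w :: A₂ ∧ w ∈ B ∧ ∀ z ∈ A₂, z ∉ B := by
  intro A
  induction A with
  | nil => simp
  | cons a A ih =>
    intro h
    by_cases h' : ∃ w ∈ A, w ∈ B
    · obtain ⟨A₁, w, A₂, e, h⟩ := ih h'
      exact ⟨a :: A₁, w, A₂, by simp [e], h⟩
    · push Not at h'
      refine ⟨[], a, A, rfl, ?_, h'⟩
      obtain ⟨w, hw, hB⟩ := h
      rcases List.mem_cons.1 hw with rfl | hw
      · exact hB
      · exact absurd hB (h' w hw)

theorem okt_dir {H : MixedGraph V} {Z : Set V} {u w v : V} (h : H.dir w v) (hw : w ∉ Z) :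
    OKT H Z u w v := Or.inr ⟨fun hc => not_arrow h hc.2, hw⟩

theorem okt_dir' {H : MixedGraph V} {Z : Set V} {u w v : V} (h : H.dir w u) (hw : w ∉ Z) :
    OKT H Z u w v := Or.inr ⟨fun hc => not_arrow h hc.1, hw⟩

theorem trip_dir {H : MixedGraph V} {Z : Set V} : ∀ {l : List V}, l.IsChain H.dir →
    (∀ w ∈ l, w ∉ Z) → Trip (OKT H Z) l := by
  intro l h hZ l₁ u w v l₂ e
  subst e
  have := h.right_of_append
  simp only [List.isChain_cons_cons] at this
  exact okt_dir this.2.1 (hZ w (by simp))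

theorem trip_mid {H : MixedGraph V} {Z : Set V} {b : V} {B : List V}
    (hB : (b :: B).IsChain H.dir) (hZ : ∀ w ∈ b :: B, w ∉ Z) :
    ∀ (mid : List V) (a : V), (∀ w ∈ mid, AncSet H Z w) → Trip (Coll H) (a :: (mid ++ [b])) →
    Trip (OKT H Z) (a :: (mid ++ b :: B)) := by
  intro mid
  induction mid with
  | nil =>
    intro a _ _
    cases B with
    | nil => exact Trip.two
    | cons c B =>
      rw [List.isChain_cons_cons] at hB
      exact Trip.cons (okt_dir hB.1 (hZ b (by simp)))
        (trip_dir (List.isChain_cons_cons.2 hB) hZ)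
  | cons m ms ih =>
    intro a hS hC
    have h1 := ih m (fun w hw => hS w (List.mem_cons_of_mem _ hw)) hC.tail
    cases ms with
    | nil => exact Trip.cons (Or.inl ⟨hC.head, hS m (by simp)⟩) h1
    | cons m' ms => exact Trip.cons (Or.inl ⟨hC.head, hS m (by simp)⟩) h1

theorem trip_rev {H : MixedGraph V} {Z : Set V} : ∀ (A : List V) (a : V) (T : List V),
    (a :: A).IsChain H.dir → (∀ w ∈ a :: A, w ∉ Z) → Trip (OKT H Z) (a :: T) →
    Trip (OKT H Z) (A.reverse ++ a :: T) := by
  intro A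
  induction A with
  | nil => intro a T _ _ h; simpa using h
  | cons a' A ih =>
    intro a T hA hZ hT
    rw [List.isChain_cons_cons] at hA
    have : Trip (OKT H Z) (a' :: a :: T) := by
      cases T with
      | nil => exact Trip.two
      | cons t T => exact Trip.cons (okt_dir' hA.1 (hZ a (by simp))) hT
    have := ih a' (a :: T) hA.2 (fun w hw => hZ w (List.mem_cons_of_mem _ hw)) this
    simpa using this

theorem chain_rev {H : MixedGraph V} : ∀ (A : List V) (a : V) (T : List V),
    (a :: A).IsChain H.dir → (a :: T).IsChain H.adj → (A.reverse ++ a :: T).IsChain H.adj := by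
  intro A
  induction A with
  | nil => intro a T _ h; simpa using h
  | cons a' A ih =>
    intro a T hA hT
    rw [List.isChain_cons_cons] at hA
    have := ih a' (a :: T) hA.2 (List.isChain_cons_cons.2 ⟨Or.inr (Or.inl hA.1), hT⟩)
    simpa using this

theorem head_rev {A T : List V} {a x : V} (h : (a :: A).getLast? = some x) :
    (A.reverse ++ a :: T).head? = some x := by
  have e : A.reverse ++ a :: T = (a :: A).reverse ++ T := by simp
  rw [e, List.head?_append, List.head?_reverse, h]
  rfl

/-- An inducing path yields a connecting path given any set. -/
theorem inducing {H : MixedGraph V} {x y : V} {Z : Set V} (hxy : x ≠ y)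
    (hx : ¬ AncSet H Z x) (hy : ¬ AncSet H Z y) {p : List V} (hp : IsPathBetween H p x y)
    (hC : Trip (Coll H) p)
    (hA : ∀ w ∈ p, ReflTransGen H.dir w x ∨ ReflTransGen H.dir w y) :
    ∃ N, IsPathBetween H N x y ∧ Trip (OKT H Z) N := by
  obtain ⟨p1, p2, p3, p4, p5⟩ := hp
  have p1 : p.IsChain H.adj := p1
  -- it suffices to construct with no length condition
  suffices h : ∃ N : List V, N.IsChain H.adj ∧ N.Nodup ∧ N.head? = some x ∧
      N.getLast? = some y ∧ Trip (OKT H Z) N by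
    obtain ⟨N, h1, h2, h3, h4, h5⟩ := h
    refine ⟨N, ⟨h1, h2, h3, h4, ?_⟩, h5⟩
    match N, h3, h4 with
    | [], h3, _ => simp at h3
    | [a], h3, h4 => simp at h3 h4; exact absurd (h3.symm.trans h4) hxy
    | a :: b :: l, _, _ => simp
  cases p with
  | nil => simp at p3
  | cons x' l =>
  simp at p3; subst p3
  have hyl : y ∈ l := by
    have := List.mem_of_getLast? p4
    rcases List.mem_cons.1 this with h | h
    · exact absurd h.symm hxy
    · exact h
  obtain ⟨l₁, a, mid, b, l₂, e, ha, hb, hm⟩ := split_list (AncSet H Z)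
    (fun w => ¬ AncSet H Z w ∧ ReflTransGen H.dir w x')
    (fun w => ¬ AncSet H Z w ∧ ReflTransGen H.dir w y) l x' [] ⟨hx, .refl⟩ (by simp)
    (by intro w hw
        by_cases hS : AncSet H Z w
        · exact Or.inl hS
        · rcases hA w (List.mem_cons_of_mem _ hw) with h | h
          · exact Or.inr (Or.inl ⟨hS, h⟩)
          · exact Or.inr (Or.inr ⟨hS, h⟩))
    ⟨y, hyl, hy, .refl⟩
  rw [List.nil_append] at e
  obtain ⟨A, A1, A2, A3⟩ := path_of_rtg ha.2
  obtain ⟨B, B1, B2, B3⟩ := path_of_rtg hb.2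
  have AS : ∀ w ∈ a :: A, ¬ AncSet H Z w := fun w hw ⟨d, hd, hwd⟩ =>
    ha.1 ⟨d, hd, (rtg_of_chain A1 w hw).trans hwd⟩
  have BS : ∀ w ∈ b :: B, ¬ AncSet H Z w := fun w hw ⟨d, hd, hwd⟩ =>
    hb.1 ⟨d, hd, (rtg_of_chain B1 w hw).trans hwd⟩
  have NZ : ∀ w, ¬ AncSet H Z w → w ∉ Z := fun w h hw => h ⟨w, hw, .refl⟩
  have dadj : ∀ u v, H.dir u v → H.adj u v := fun u v h => Or.inl h
  by_cases hAB : ∃ w ∈ a :: A, w ∈ b :: B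
  · obtain ⟨A₁, w, A₂, eA, hwB, hdis⟩ := last_common _ _ hAB
    obtain ⟨B₁, B₂, eB⟩ := List.append_of_mem hwB
    rw [eA] at A1 A2 A3 AS
    rw [eB] at B1 B2 B3 BS hdis
    have A1' := A1.right_of_append
    have B1' := B1.right_of_append
    have A2' := (List.nodup_append.1 A2).2.1
    have B2' := (List.nodup_append.1 B2).2.1
    have A3' : (w :: A₂).getLast? = some x' := by simpa [List.getLast?_append] using A3
    have B3' : (w :: B₂).getLast? = some y := by simpa [List.getLast?_append] using B3
    refine ⟨A₂.reverse ++ w :: B₂, chain_rev _ _ _ A1' (B1'.imp dadj), ?_, head_rev A3', ?_, ?_⟩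
    · rw [List.nodup_append]
      refine ⟨List.nodup_reverse.2 (List.nodup_cons.1 A2').2, B2', ?_⟩
      rintro z hz z' hz' rfl
      exact hdis z (List.mem_reverse.1 hz) (List.mem_append_right _ hz')
    · simpa [List.getLast?_append] using B3'
    · exact trip_rev _ _ _ A1' (fun z hz => NZ z (AS z (List.mem_append_right _ hz)))
        (trip_dir B1' (fun z hz => NZ z (BS z (List.mem_append_right _ hz))))
  · rw [e] at p1 p2 hC
    have q1 := p1.right_of_append
    have q2 := (List.nodup_append.1 p2).2.1
    have q3 : Trip (Coll H) (a :: (mid ++ [b])) := by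
      have h := hC.suffix
      have e' : a :: (mid ++ b :: l₂) = (a :: (mid ++ [b])) ++ l₂ := by simp
      rw [e'] at h
      exact h.pref
    have c1 : (a :: (mid ++ b :: B)).IsChain H.adj := by
      have e' : a :: (mid ++ b :: l₂) = (a :: mid) ++ b :: l₂ := by simp
      rw [e', List.isChain_split] at q1
      have e'' : a :: (mid ++ b :: B) = (a :: mid) ++ b :: B := by simp
      rw [e'', List.isChain_split]
      exact ⟨q1.1, B1.imp dadj⟩
    push Not at hAB
    refine ⟨A.reverse ++ a :: (mid ++ b :: B), chain_rev _ _ _ A1 c1, ?_, head_rev A3, ?_, ?_⟩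
    · have e' : A.reverse ++ a :: (mid ++ b :: B) = (a :: A).reverse ++ (mid ++ b :: B) := by simp
      rw [e', List.nodup_append]
      have mn : mid.Nodup := (List.nodup_append.1 (List.nodup_cons.1 q2).2).1
      refine ⟨List.nodup_reverse.2 A2, ?_, ?_⟩
      · rw [List.nodup_append]
        refine ⟨mn, B2, ?_⟩
        rintro z hz z' hz' rfl
        exact BS z hz' (hm z hz)
      · rintro z hz z' hz' rfl
        rw [List.mem_reverse] at hz
        rcases List.mem_append.1 hz' with h | h
        · exact AS z hz (hm z h)
        · exact hAB z hz h
    · rw [← List.cons_append, ← List.append_assoc, List.getLast?_append, B3]; rfl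
    · exact trip_rev _ _ _ A1 (fun z hz => NZ z (AS z hz))
        (trip_mid B1 (fun z hz => NZ z (BS z hz)) mid a hm q3)

theorem fwd {H : MixedGraph V} {Z : Set V} {y : V} : ∀ (l : List V) (w v : V),
    (w :: v :: l).IsChain H.adj → Trip (OKT H Z) (w :: v :: l) →
    (w :: v :: l).getLast? = some y → H.dir w v →
    AncSet H Z w ∨ ReflTransGen H.dir w y := by
  intro l
  induction l with
  | nil =>
    intro w v _ _ h hd
    simp at h; subst h
    exact Or.inr (.single hd)
  | cons t l ih =>
    intro w v hc ht hl hd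
    rw [List.isChain_cons_cons] at hc
    have key : AncSet H Z v ∨ ReflTransGen H.dir v y := by
      rcases ht.head with h | h
      · exact Or.inl h.2
      · refine ih v t hc.2 ht.tail (by simpa using hl) ?_
        refine dir_of_not_arrow (List.isChain_cons_cons.1 hc.2).1 ?_
        intro h'
        exact h.1 ⟨Or.inl hd, h'⟩
    rcases key with ⟨d, hd', h⟩ | h
    · exact Or.inl ⟨d, hd', .head hd h⟩
    · exact Or.inr (.head hd h)

theorem okt_symm {H : MixedGraph V} {Z : Set V} {u w v : V} (h : OKT H Z u w v) :
    OKT H Z v w u := by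
  rcases h with h | h
  · exact Or.inl ⟨⟨h.1.2, h.1.1⟩, h.2⟩
  · exact Or.inr ⟨fun h' => h.1 ⟨h'.2, h'.1⟩, h.2⟩

theorem trip_reverse {H : MixedGraph V} {Z : Set V} {p : List V} (h : Trip (OKT H Z) p) :
    Trip (OKT H Z) p.reverse := by
  intro l₁ u w v l₂ e
  apply okt_symm
  apply h l₂.reverse v w u l₁.reverse
  have := congrArg List.reverse e
  simpa using this

theorem inter_anc {H : MixedGraph V} {Z : Set V} {x y : V} {p : List V}
    (hp : IsPathBetween H p x y) (ht : Trip (OKT H Z) p) {l₁ l₂ : List V} {u w v : V}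
    (e : p = l₁ ++ u :: w :: v :: l₂) :
    AncSet H Z w ∨ ReflTransGen H.dir w x ∨ ReflTransGen H.dir w y := by
  obtain ⟨p1, p2, p3, p4, p5⟩ := hp
  have p1 : p.IsChain H.adj := p1
  rcases ht _ _ _ _ _ e with h | h
  · exact Or.inl h.2
  have hc := p1
  rw [e] at hc
  have hc := hc.right_of_append
  simp only [List.isChain_cons_cons] at hc
  by_cases hu : ArrowInto H u w
  · have hd : H.dir w v := dir_of_not_arrow hc.2.1 (fun h' => h.1 ⟨hu, h'⟩)
    have e' : p = (l₁ ++ [u]) ++ w :: v :: l₂ := by simp [e]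
    rw [e'] at p1 ht p4
    rcases fwd l₂ w v p1.right_of_append ht.suffix
      (by simpa [List.getLast?_append] using p4) hd with h | h
    · exact Or.inl h
    · exact Or.inr (Or.inr h)
  · have hd : H.dir w u := dir_of_not_arrow (H.adj_symm hc.1) hu
    have e' : p.reverse = (l₂.reverse ++ [v]) ++ w :: u :: l₁.reverse := by simp [e]
    have r1 : p.reverse.IsChain H.adj := by
      rw [List.isChain_reverse]
      exact p1.imp (fun a b h => H.adj_symm h)
    have r2 := trip_reverse ht
    have r3 : p.reverse.getLast? = some x := by simpa using p3
    rw [e'] at r1 r2 r3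
    rcases fwd l₁.reverse w u r1.right_of_append r2.suffix
      (by rwa [List.getLast?_append_of_ne_nil _ (by simp)] at r3) hd with h | h
    · exact Or.inl h
    · exact Or.inr (Or.inl h)

/-- The D-SEP set. -/
def DSep (H : MixedGraph V) (x y : V) : Set V :=
  {v | v ≠ x ∧ v ≠ y ∧ ∃ s, IsPathBetween H s v y ∧ Trip (Coll H) s ∧
    ∀ w ∈ s, ReflTransGen H.dir w x ∨ ReflTransGen H.dir w y}

theorem dsep_inducing {H : MixedGraph V} {x y : V} {p : List V}
    (hp : IsPathBetween H p x y) (ht : Trip (OKT H (DSep H x y)) p) :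
    Trip (Coll H) p ∧ ∀ w ∈ p, ReflTransGen H.dir w x ∨ ReflTransGen H.dir w y := by
  have hA : ∀ w ∈ p, ReflTransGen H.dir w x ∨ ReflTransGen H.dir w y := by
    intro w hw
    obtain ⟨l₁, l₂, e⟩ := List.append_of_mem hw
    rcases List.eq_nil_or_concat l₁ with rfl | ⟨l, u, rfl⟩
    · have := hp.2.2.1
      rw [e] at this
      simp at this
      subst this; exact Or.inl .refl
    cases l₂ with
    | nil =>
      have := hp.2.2.2.1
      rw [e] at this
      simp at this
      subst this; exact Or.inr .refl
    | cons v l₂ =>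
      rcases inter_anc hp ht (l₁ := l) (u := u) (w := w) (v := v) (l₂ := l₂)
        (by simp [e]) with ⟨d, ⟨_, _, s, hs, _, hs'⟩, h⟩ | h
      · have hd : d ∈ s := by
          have := hs.2.2.1
          exact List.mem_of_head? this
        rcases hs' d hd with h' | h'
        · exact Or.inl (h.trans h')
        · exact Or.inr (h.trans h')
      · exact h
  refine ⟨?_, hA⟩
  have key : ∀ (s l : List V), p = l ++ s → Trip (Coll H) s := by
    intro s
    induction s with
    | nil => intro _ _; exact Trip.nil
    | cons w s ih =>
      intro l e
      have hs := ih (l ++ [w]) (by simp [e])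
      match s, hs, e with
      | [], _, _ => exact Trip.one
      | [_], _, _ => exact Trip.two
      | v :: v' :: t, hs, e =>
        refine Trip.cons ?_ hs
        rcases ht _ _ _ _ _ e with h | h
        · exact h.1
        exfalso
        apply h.2
        obtain ⟨p1, p2, p3, p4, p5⟩ := hp
        have p1 : p.IsChain H.adj := p1
        have e' : p = (l ++ [w]) ++ v :: v' :: t := by simp [e]
        have hx : x ∈ l ++ [w] := by
          rw [e', List.head?_append_of_ne_nil _ (by simp)] at p3
          exact List.mem_of_head? p3
        have hy : (v' :: t).getLast? = some y := by
          rw [e'] at p4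
          simpa [List.getLast?_append] using p4
        rw [e'] at p1 p2 p4
        have n := List.nodup_append.1 p2
        refine ⟨?_, ?_, v :: v' :: t, ⟨p1.right_of_append, n.2.1, rfl, ?_, by simp⟩, hs, ?_⟩
        · rintro rfl
          exact n.2.2 v hx v (by simp) rfl
        · rintro rfl
          exact (List.nodup_cons.1 n.2.1).1 (List.mem_of_getLast? hy)
        · simpa using hy
        · intro z hz
          exact hA z (by rw [e']; exact List.mem_append_right _ hz)
  exact key p [] rfl

/-- Delete the directed edge from x to y. -/
def cut (G : MixedGraph V) (x y : V) : MixedGraph V where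
  dir a b := G.dir a b ∧ ¬ (a = x ∧ b = y)
  bidir := G.bidir
  bidir_symm := G.bidir_symm
  dir_irrefl a h := G.dir_irrefl a h.1
  bidir_irrefl := G.bidir_irrefl
  dir_not_dir a b h h' := G.dir_not_dir a b h.1 h'.1
  dir_not_bidir a b h := G.dir_not_bidir a b h.1

theorem cut_arrow {G : MixedGraph V} {x y u w : V} (h : w ≠ y) :
    ArrowInto (cut G x y) u w ↔ ArrowInto G u w := by
  simp [ArrowInto, cut, h]

theorem cut_arrow_mono {G : MixedGraph V} {x y u w : V} (h : ArrowInto (cut G x y) u w) :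
    ArrowInto G u w := h.imp (fun h => h.1) id

theorem cut_adj_mono {G : MixedGraph V} {x y u w : V} (h : (cut G x y).adj u w) :
    G.adj u w := h.imp (fun h => h.1) (Or.imp (fun h => h.1) id)

theorem cut_rtg_mono {G : MixedGraph V} {x y u w : V} (h : ReflTransGen (cut G x y).dir u w) :
    ReflTransGen G.dir u w := by
  induction h with
  | refl => exact .refl
  | tail _ h ih => exact .tail ih h.1

theorem cut_path {G : MixedGraph V} {x y a b : V} {p : List V}
    (h : IsPathBetween (cut G x y) p a b) : IsPathBetween G p a b :=
  ⟨List.IsChain.imp (fun _ _ => cut_adj_mono) h.1, h.2⟩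

theorem inter_ne {G : MixedGraph V} {x y : V} {p l₁ l₂ : List V} {u w v : V}
    (hp : IsPathBetween G p x y) (e : p = l₁ ++ u :: w :: v :: l₂) : w ≠ y := by
  rintro rfl
  obtain ⟨_, p2, _, p4, _⟩ := hp
  rw [e] at p2 p4
  have h4 : (v :: l₂).getLast? = some w := by simpa [List.getLast?_append] using p4
  have n := (List.nodup_append.1 p2).2.1
  simp only [List.nodup_cons] at n
  exact n.2.1 (List.mem_of_getLast? h4)

theorem triple_unique {l₁ l₂ m₁ m₂ : List V} {u w v u' v' : V}
    (n : (l₁ ++ u :: w :: v :: l₂).Nodup)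
    (e : l₁ ++ u :: w :: v :: l₂ = m₁ ++ u' :: w :: v' :: m₂) : u = u' ∧ v = v' := by
  have e1 : (l₁ ++ [u]) ++ w :: (v :: l₂) = (m₁ ++ [u']) ++ w :: (v' :: m₂) := by simpa using e
  have n1 : ((l₁ ++ [u]) ++ w :: (v :: l₂)).Nodup := by simpa using n
  have n2 := n1
  rw [e1] at n2
  have h1 : w ∉ l₁ ++ [u] := fun h => (List.nodup_append.1 n1).2.2 w h w (by simp) rfl
  have h2 : w ∉ m₁ ++ [u'] := fun h => (List.nodup_append.1 n2).2.2 w h w (by simp) rfl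
  have h3 : l₁ ++ [u] = m₁ ++ [u'] ∧ v :: l₂ = v' :: m₂ := by
    rcases List.append_eq_append_iff.1 e1 with ⟨a, ha, hb⟩ | ⟨a, ha, hb⟩
    · cases a with
      | nil => simp at ha hb; simp [ha, hb]
      | cons z a =>
        simp at hb
        exact absurd (by rw [ha, hb.1]; simp) h2
    · cases a with
      | nil => simp at ha hb; simp [ha, hb]
      | cons z a =>
        simp at hb
        exact absurd (by rw [ha, hb.1]; simp) h1
  simp at h3
  exact ⟨h3.1.2, h3.2.1⟩

theorem cut_coll {G : MixedGraph V} {x y u w v : V} (h : w ≠ y) :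
    Coll (cut G x y) u w v ↔ Coll G u w v := by
  simp only [Coll, cut_arrow h]

theorem mconn_of_trip {G : MixedGraph V} {x y : V} {Z : Set V} {p : List V}
    (hx : x ∉ Z) (hy : y ∉ Z)
    (hp : IsPathBetween (cut G x y) p x y) (ht : Trip (OKT (cut G x y) Z) p) :
    MConnPath G Z p x y := by
  refine ⟨cut_path hp, hx, hy, ?_, ?_⟩
  · rintro w ⟨⟨u, v, l₁, l₂, e⟩, hn⟩
    rcases ht _ _ _ _ _ e with h | h
    · exact absurd ⟨u, v, l₁, l₂, e, (cut_coll (inter_ne hp e)).1 h.1⟩ hn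
    · exact h.2
  · rintro w ⟨u, v, l₁, l₂, e, h1⟩
    rcases ht _ _ _ _ _ e with h | h
    · obtain ⟨d, hd, h⟩ := h.2
      exact ⟨d, hd, anc_iff.2 (cut_rtg_mono h)⟩
    · exact absurd ((cut_coll (inter_ne hp e)).2 h1) h.1

theorem trip_of_mconn {G : MixedGraph V} {x y : V} {O Z : Set V} (h : Pretreatment G x y O)
    (hZ : Z ⊆ O) {p : List V} (hm : MConnPath G Z p x y) : Trip (OKT (cut G x y) Z) p := by
  intro l₁ u w v l₂ e
  obtain ⟨hp, _, _, h1, h2⟩ := hm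
  have hw := inter_ne hp e
  have rt : ∀ w, ∀ d ∈ Z, ReflTransGen G.dir w d → ReflTransGen (cut G x y).dir w d := by
    clear hw e
    intro w d hd hr
    induction hr using ReflTransGen.head_induction_on with
    | refl => exact .refl
    | head hac hcd ih =>
      rename_i a c
      by_cases hc : a = x ∧ c = y
      · obtain ⟨rfl, rfl⟩ := hc
        exact absurd (anc_iff.2 hcd) (h.y_not_anc_O d (hZ hd))
      · exact .head ⟨hac, hc⟩ ih
  rw [OKT, cut_coll hw]
  by_cases hc : Coll G u w v
  · obtain ⟨d, hd, hwd⟩ := h2 w ⟨u, v, l₁, l₂, e, hc⟩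
    exact Or.inl ⟨hc, d, hd, rt w d hd (anc_iff.1 hwd)⟩
  · refine Or.inr ⟨hc, h1 w ⟨⟨u, v, l₁, l₂, e⟩, ?_⟩⟩
    rintro ⟨u', v', m₁, m₂, e', h'⟩
    have n := hp.2.1
    rw [e] at n e'
    obtain ⟨rfl, rfl⟩ := triple_unique n e'
    exact hc h'

theorem path_cut_of_noncausal {G : MixedGraph V} {x y : V} (hxy : x ≠ y) {p : List V}
    (hp : NonCausalPath G p x y) : IsPathBetween (cut G x y) p x y := by
  obtain ⟨⟨p1, p2, p3, p4, p5⟩, hn⟩ := hp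
  have p1 : p.IsChain G.adj := p1
  refine ⟨?_, p2, p3, p4, p5⟩
  match p, p1, p2, p3, p4, p5, hn with
  | a :: b :: l, p1, p2, p3, p4, p5, hn =>
    simp at p3; subst p3
    change List.IsChain _ _
    rw [List.isChain_cons_cons] at p1 ⊢
    constructor
    · rcases p1.1 with h | h | h
      · refine Or.inl ⟨h, ?_⟩
        rintro ⟨_, rfl⟩
        apply hn
        cases l with
        | nil =>
          refine ⟨?_, p2, rfl, p4, by simp⟩
          change List.IsChain _ _
          simpa using h
        | cons c l =>
          have h4 : (c :: l).getLast? = some b := by simpa using p4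
          have := (List.nodup_cons.1 (List.nodup_cons.1 p2).2).1
          exact absurd (List.mem_of_getLast? h4) this
      · exact Or.inr (Or.inl ⟨h, fun h' => hxy h'.2⟩)
      · exact Or.inr (Or.inr h)
    · have na := (List.nodup_cons.1 p2).1
      have : ∀ (l : List V), a ∉ l → l.IsChain G.adj → l.IsChain (cut G a y).adj := by
        intro l
        induction l with
        | nil => simp
        | cons c l ih =>
          intro hc h
          cases l with
          | nil => simp
          | cons d l =>
            rw [List.isChain_cons_cons] at h ⊢
            refine ⟨?_, ih (fun h => hc (List.mem_cons_of_mem _ h)) h.2⟩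
            have c1 : c ≠ a := fun h => hc (by simp [h])
            have d1 : d ≠ a := fun h => hc (by simp [h])
            rcases h.1 with h | h | h
            · exact Or.inl ⟨h, fun h => c1 h.1⟩
            · exact Or.inr (Or.inl ⟨h, fun h => d1 h.1⟩)
            · exact Or.inr (Or.inr h)
      exact this _ na p1.2

/-- Theorem 1 (Existence of an adjustment set within the Markov blanket):
some subset of `O` is a valid adjustment set relative to `(x, y)` iff some
subset of `MB(y) \ {x}` is. -/
theorem adjustment_set_in_markov_blanket
    {V : Type*} [Fintype V] (G : MixedGraph V) (x y : V) (O : Set V)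
    (h : Pretreatment G x y O) :
    (∃ Z ⊆ O, ValidAdjustment G x y Z) ↔
      (∃ Z ⊆ MarkovBlanket G y \ {x}, ValidAdjustment G x y Z) := by
  have cov : ∀ v, v ≠ x → v ≠ y → v ∈ O := by
    intro v hx hy
    have : v ∈ ({x, y} ∪ O : Set V) := h.cover ▸ Set.mem_univ v
    rcases this with (h | h) | h
    · exact absurd h hx
    · exact absurd h hy
    · exact h
  constructor
  · rintro ⟨Z, hZ, v1, v2, v3⟩
    have hDO : DSep (cut G x y) x y ⊆ O := fun v hv => cov v hv.1 hv.2.1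
    refine ⟨DSep (cut G x y) x y, ?_, v1, ?_, ?_⟩
    · intro v hv
      obtain ⟨hx, hy, s, hs, hc, _⟩ := hv
      refine ⟨⟨hy, ?_⟩, hx⟩
      by_cases ha : G.adj v y
      · exact Or.inl ha
      · refine Or.inr ⟨ha, s, cut_path hs, ?_⟩
        rintro w ⟨u, t, l₁, l₂, e⟩
        have := hc _ _ _ _ _ e
        exact ⟨u, t, l₁, l₂, e, cut_arrow_mono this.1, cut_arrow_mono this.2⟩
    · rintro v hv ⟨w, p, hp, hw, ha⟩
      have hvO := hDO hv
      obtain ⟨p1, p2, p3, p4, p5⟩ := hp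
      cases p with
      | nil => simp at p3
      | cons c l =>
        simp at p3; subst p3
        exact h.x_not_anc_O v hvO (anc_iff.2 ((rtg_of_chain p1 w hw).trans (anc_iff.1 ha)))
    · intro p hp hm
      have hpc := path_cut_of_noncausal h.ne hp
      obtain ⟨hC, hA⟩ := dsep_inducing hpc (trip_of_mconn h hDO hm)
      obtain ⟨N, hN, hT⟩ := inducing (Z := Z) h.ne
        (fun ⟨d, hd, hr⟩ => h.x_not_anc_O d (hZ hd) (anc_iff.2 (cut_rtg_mono hr)))
        (fun ⟨d, hd, hr⟩ => h.y_not_anc_O d (hZ hd) (anc_iff.2 (cut_rtg_mono hr))) hpc hC hA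
      refine v3 N ⟨cut_path hN, ?_⟩ (mconn_of_trip (fun hx => h.x_not_mem (hZ hx))
        (fun hy => h.y_not_mem (hZ hy)) hN hT)
      rintro ⟨d1, _, d3, _, d5⟩
      have d1 : N.IsChain G.dir := d1
      have n1 : N.IsChain (cut G x y).adj := hN.1
      match N, d1, n1, d3, d5 with
      | a :: b :: l, d1, n1, d3, _ =>
        simp at d3; subst d3
        rw [List.isChain_cons_cons] at d1 n1
        have hb : b = y := by
          by_contra hb
          have hba : b ≠ a := by
            rintro rfl
            exact G.dir_irrefl _ d1.1
          exact h.x_not_anc_O b (cov b hba hb) (anc_iff.2 (.single d1.1))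
        subst hb
        rcases n1.1 with h' | h' | h'
        · exact h'.2 ⟨rfl, rfl⟩
        · exact G.dir_not_dir _ _ d1.1 h'.1
        · exact G.dir_not_bidir _ _ d1.1 h'
  · rintro ⟨Z, hZ, hv⟩
    exact ⟨Z, fun v hvZ => cov v (hZ hvZ).2 (hZ hvZ).1.1, hv⟩


end CausalGraph
end

section
/- Let M be a MAG over V = {X, Y} ∪ O satisfying the pretreatment setup, let S ∈ O, and let Z ⊆ O \ {S}. If M contains the directed edge X → Y and S and X are m-connected given Z, then S and Y are m-connected given Z. (Core step in the proof of Theorem 3, condition (ii): an active path into X concatenated with the edge X → Y yields an active path to Y.) -/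
namespace CausalGraph

variable {V : Type*}

lemma nodup_split_unique {w : V} : ∀ (a b a' b' : List V), (a ++ w :: b).Nodup →
    a ++ w :: b = a' ++ w :: b' → a = a' ∧ b = b'
  | [], b, [], b', _, e => by simpa using e
  | [], b, c :: a', b', hn, e => by
      simp only [List.nil_append, List.cons_append, List.cons.injEq] at e
      obtain ⟨_, rfl⟩ := e
      simp at hn
  | c :: a, b, [], b', hn, e => by
      simp only [List.nil_append, List.cons_append, List.cons.injEq] at e
      obtain ⟨rfl, _⟩ := e
      simp at hn
  | c :: a, b, d :: a', b', hn, e => by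
      simp only [List.cons_append, List.cons.injEq] at e
      have := nodup_split_unique a b a' b' (by simp at hn ⊢; tauto) e.2
      exact ⟨by rw [e.1, this.1], this.2⟩

/-- Core step in the proof of Theorem 3 (condition (ii)): an active path into
`x` concatenated with the edge `x → y` yields an active path to `y`. -/
theorem mconn_extends_along_directed_edge
    {V : Type*} [Fintype V] (G : MixedGraph V) (x y : V) (O : Set V)
    (h : Pretreatment G x y O) (S : V) (hS : S ∈ O)
    (Z : Set V) (hZ : Z ⊆ O \ {S})
    (hdir : G.dir x y) (hconn : MConn G Z S x) :
    MConn G Z S y := by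
  obtain ⟨p, ⟨hch, hnd, hhd, hlast, hlen⟩, hSZ, hxZ, hnc, hc⟩ := hconn
  have hyZ : y ∉ Z := fun hy => h.y_not_mem (hZ hy).1
  have hSy : S ≠ y := fun e => h.y_not_mem (e ▸ hS)
  by_cases hy : y ∈ p
  · obtain ⟨l, m, rfl⟩ := List.append_of_mem hy
    have hl : l ≠ [] := by
      rintro rfl
      simp at hhd
      exact hSy hhd.symm
    have hpre : l ++ y :: m = (l ++ [y]) ++ m := by simp
    rw [hpre] at hch hnd hhd hnc hc
    refine ⟨l ++ [y], ⟨(List.isChain_append.1 hch).1, (List.nodup_append.1 hnd).1, ?_, by simp, ?_⟩,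
      hSZ, hyZ, ?_, ?_⟩
    · cases l with
      | nil => exact absurd rfl hl
      | cons a l => simpa using hhd
    · cases l with
      | nil => exact absurd rfl hl
      | cons a l => simp
    · rintro w ⟨⟨u, v, l₁, l₂, e⟩, hw⟩
      refine hnc w ⟨⟨u, v, l₁, l₂ ++ m, by simp [e]⟩, ?_⟩
      rintro ⟨u', v', l₁', l₂', e', h1, h2⟩
      apply hw
      have hp : l ++ [y] ++ m = (l₁ ++ [u]) ++ w :: (v :: l₂ ++ m) := by simp [e]
      have hp' : l ++ [y] ++ m = (l₁' ++ [u']) ++ w :: (v' :: l₂') := by simp [e']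
      obtain ⟨e1, e2⟩ := nodup_split_unique _ _ _ _ (hp ▸ hnd) (hp.symm.trans hp')
      have hu : u = u' := by
        have := congrArg List.getLast? e1
        simpa using this
      have hv : v = v' := by
        simp only [List.cons_append, List.cons.injEq] at e2
        exact e2.1
      subst hu hv
      exact ⟨u, v, l₁, l₂, e, h1, h2⟩
    · rintro w ⟨u, v, l₁, l₂, e, h1, h2⟩
      exact hc w ⟨u, v, l₁, l₂ ++ m, by simp [e], h1, h2⟩
  · -- any split of `p ++ [y]` at an intermediate vertex
    have key : ∀ u w v l₁ l₂, p ++ [y] = l₁ ++ u :: w :: v :: l₂ →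
        (w = x ∧ v = y) ∨ ∃ l₃, p = l₁ ++ u :: w :: v :: l₃ := by
      intro u w v l₁ l₂ e
      rcases List.eq_nil_or_concat l₂ with rfl | ⟨l₃, z, rfl⟩
      · left
        have e' : p ++ [y] = (l₁ ++ [u, w]) ++ [v] := by simp [e]
        obtain ⟨e1, e2⟩ := List.append_inj' e' rfl
        subst e1
        simp at hlast e2
        exact ⟨hlast, e2.symm⟩
      · right
        have e' : p ++ [y] = (l₁ ++ u :: w :: v :: l₃) ++ [z] := by simp [e]
        exact ⟨l₃, (List.append_inj' e' rfl).1⟩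
    refine ⟨p ++ [y], ⟨?_, ?_, ?_, by simp, by simp; omega⟩, hSZ, hyZ, ?_, ?_⟩
    · refine List.isChain_append.2 ⟨hch, by simp, ?_⟩
      intro a ha b hb
      rw [hlast] at ha
      simp at ha hb
      subst ha hb
      exact Or.inl hdir
    · rw [List.nodup_append]
      refine ⟨hnd, by simp, ?_⟩
      intro a ha b hb e
      simp at hb
      subst hb e
      exact hy ha
    · simp [hhd]
    · rintro w ⟨⟨u, v, l₁, l₂, e⟩, hw⟩
      rcases key _ _ _ _ _ e with ⟨rfl, _⟩ | ⟨l₃, e'⟩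
      · exact hxZ
      · refine hnc w ⟨⟨u, v, l₁, l₃, e'⟩, ?_⟩
        rintro ⟨u', v', l₁', l₂', e', h1, h2⟩
        exact hw ⟨u', v', l₁', l₂' ++ [y], by simp [e'], h1, h2⟩
    · rintro w ⟨u, v, l₁, l₂, e, h1, h2⟩
      rcases key _ _ _ _ _ e with ⟨rfl, rfl⟩ | ⟨l₃, e'⟩
      · rcases h2 with h2 | h2
        · exact absurd h2 (G.dir_not_dir _ _ hdir)
        · exact absurd (G.bidir_symm _ _ h2) (G.dir_not_bidir _ _ hdir)
      · exact hc w ⟨u, v, l₁, l₃, e', h1, h2⟩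

end CausalGraph
end
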